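/- Let P ∈ ℂ[X₁,…,Xₙ]. Then P is of type A if and only if P is of type B; that is, every positive definite linear functional on ℂ[X₁,…,Xₙ] vanishing on the ideal (P) is a moment functional if and only if every positive definite linear functional vanishing on I_ℂ(Z_P) is a moment functional. -/

import Mathlib

open MeasureTheory
open scoped ComplexOrder

noncomputable def evalC {n : ℕ} (P : MvPolynomial (Fin n) ℂ) (x : Fin n → ℝ) : ℂ :=
  MvPolynomial.aeval (fun i => (x i : ℂ)) P

noncomputable def starC {n : ℕ} (P : MvPolynomial (Fin n) ℂ) : MvPolynomial (Fin n) ℂ :=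
  MvPolynomial.map (starRingEnd ℂ) P

def IsPosDefC {n : ℕ} (Λ : MvPolynomial (Fin n) ℂ →ₗ[ℂ] ℂ) : Prop :=
  ∀ P : MvPolynomial (Fin n) ℂ, 0 ≤ Λ (starC P * P)

def IsMomentC {n : ℕ} (Λ : MvPolynomial (Fin n) ℂ →ₗ[ℂ] ℂ) : Prop :=
  ∃ μ : Measure (Fin n → ℝ),
    (∀ Q : MvPolynomial (Fin n) ℂ, Integrable (fun x => evalC Q x) μ) ∧
    (∀ Q : MvPolynomial (Fin n) ℂ, Λ Q = ∫ x, evalC Q x ∂μ)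

noncomputable def vanishingIdealC {n : ℕ} (Z : Set (Fin n → ℝ)) :
    Ideal (MvPolynomial (Fin n) ℂ) where
  carrier := {P | ∀ x ∈ Z, evalC P x = 0}
  add_mem' := by
    intro a b ha hb x hx
    simp only [Set.mem_setOf_eq, evalC, map_add] at *
    rw [ha x hx, hb x hx, add_zero]
  zero_mem' := by
    intro x hx
    simp [evalC]
  smul_mem' := by
    intro c a ha x hx
    simp only [Set.mem_setOf_eq, evalC, smul_eq_mul, map_mul] at *
    rw [ha x hx, mul_zero]

def zeroSetC {n : ℕ} (I : Ideal (MvPolynomial (Fin n) ℂ)) : Set (Fin n → ℝ) :=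
  {x | ∀ P ∈ I, evalC P x = 0}

def zSetC {n : ℕ} (P : MvPolynomial (Fin n) ℂ) : Set (Fin n → ℝ) :=
  {x | evalC P x = 0}

def VanishesOnC {n : ℕ} (Λ : MvPolynomial (Fin n) ℂ →ₗ[ℂ] ℂ)
    (I : Ideal (MvPolynomial (Fin n) ℂ)) : Prop :=
  ∀ P ∈ I, Λ P = 0

def nSetC {n : ℕ} (Λ : MvPolynomial (Fin n) ℂ →ₗ[ℂ] ℂ) : Set (MvPolynomial (Fin n) ℂ) :=
  {P | Λ (starC P * P) = 0}

def IsTypeAC {n : ℕ} (P : MvPolynomial (Fin n) ℂ) : Prop :=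
  ∀ Λ : MvPolynomial (Fin n) ℂ →ₗ[ℂ] ℂ,
    IsPosDefC Λ → VanishesOnC Λ (Ideal.span {P}) → IsMomentC Λ

section

open Polynomial

/-- An ordered field in which polynomials satisfy the intermediate value property. -/
def HasPolyIVT (K : Type) [Field K] [LinearOrder K] : Prop :=
  ∀ (p : K[X]) (a b : K), a < b → p.eval a * p.eval b < 0 → ∃ c, a < c ∧ c < b ∧ p.eval c = 0

section IVT

variable {K : Type} [Field K] [LinearOrder K] [IsStrictOrderedRing K]

theorem sign_eq_of_mul_pos {a b : K} (h : 0 < a * b) : SignType.sign a = SignType.sign b := by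
  rcases pos_and_pos_or_neg_and_neg_of_mul_pos h with ⟨h1, h2⟩ | ⟨h1, h2⟩
  · rw [sign_pos h1, sign_pos h2]
  · rw [sign_neg h1, sign_neg h2]

/-- Absence of roots on an interval forces constant sign. -/
theorem HasPolyIVT.sign_eval_eq (hK : HasPolyIVT K) (p : K[X]) {S : Set K} [S.OrdConnected]
    (h : ∀ x ∈ S, p.eval x ≠ 0) {a b : K} (ha : a ∈ S) (hb : b ∈ S) :
    SignType.sign (p.eval a) = SignType.sign (p.eval b) := by
  wlog hab : a < b generalizing a b
  · rcases (not_lt.mp hab).eq_or_lt with rfl | h'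
    · rfl
    · exact (this hb ha h').symm
  apply sign_eq_of_mul_pos
  rcases lt_trichotomy (p.eval a * p.eval b) 0 with h1 | h1 | h1
  · obtain ⟨c, h2, h3, h4⟩ := hK p a b hab h1
    exact absurd h4 (h c (Set.Icc_subset S ha hb ⟨h2.le, h3.le⟩))
  · rcases mul_eq_zero.mp h1 with h2 | h2
    · exact absurd h2 (h a ha)
    · exact absurd h2 (h b hb)
  · exact h1

theorem HasPolyIVT.rolle_of_consecutive (hK : HasPolyIVT K) {p : K[X]} {a b : K} (hab : a < b)
    (hp : p ≠ 0) (ha : p.eval a = 0) (hb : p.eval b = 0)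
    (h : ∀ x, a < x → x < b → p.eval x ≠ 0) :
    ∃ c, a < c ∧ c < b ∧ (derivative p).eval c = 0 := by
  obtain ⟨q, hq, hqa⟩ := Polynomial.exists_eq_pow_rootMultiplicity_mul_and_not_dvd p hp a
  set m := p.rootMultiplicity a with hm
  have hm0 : 0 < m := (rootMultiplicity_pos hp).2 ha
  have hq0 : q ≠ 0 := by rintro rfl; simp at hqa
  obtain ⟨g, hg, hgb⟩ := Polynomial.exists_eq_pow_rootMultiplicity_mul_and_not_dvd q hq0 b
  set k := q.rootMultiplicity b with hk
  have hqb : q.eval b = 0 := by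
    rw [hq] at hb
    simpa [sub_ne_zero.mpr hab.ne'] using hb
  have hk0 : 0 < k := (rootMultiplicity_pos hq0).2 hqb
  rw [dvd_iff_isRoot, IsRoot] at hqa hgb
  have hga : g.eval a ≠ 0 := by
    intro h0; apply hqa; rw [hg]; simp [h0]
  obtain ⟨m', hm'⟩ : ∃ m', m = m' + 1 := ⟨m - 1, by omega⟩
  obtain ⟨k', hk'⟩ : ∃ k', k = k' + 1 := ⟨k - 1, by omega⟩
  have hpe : p = (X - C a) ^ (m' + 1) * ((X - C b) ^ (k' + 1) * g) := by
    rw [hq, hg, hm', hk']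
  have hgs : SignType.sign (g.eval a) = SignType.sign (g.eval b) := by
    refine hK.sign_eval_eq g (S := Set.Icc a b) ?_ ⟨le_rfl, hab.le⟩ ⟨hab.le, le_rfl⟩
    rintro x ⟨h1, h2⟩
    rcases h1.eq_or_lt with rfl | h1
    · exact hga
    rcases h2.eq_or_lt with rfl | h2
    · exact hgb
    intro h0
    apply h x h1 h2
    rw [hpe]; simp [h0]
  set w : K[X] := (C ((m' : K) + 1)) * (X - C b) * g + (C ((k' : K) + 1)) * (X - C a) * g
    + (X - C a) * (X - C b) * derivative g with hw
  have hder : derivative p = (X - C a) ^ m' * (X - C b) ^ k' * w := by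
    rw [hpe, hw]
    simp [derivative_mul, derivative_pow]
    ring
  have hwab : w.eval a * w.eval b < 0 := by
    have e1 : w.eval a = ((m' : K) + 1) * (a - b) * g.eval a := by rw [hw]; simp
    have e2 : w.eval b = ((k' : K) + 1) * (b - a) * g.eval b := by rw [hw]; simp
    have e3 : 0 < g.eval a * g.eval b := by
      rcases lt_or_gt_of_ne hga with h1 | h1
      · rw [sign_neg h1, eq_comm, sign_eq_neg_one_iff] at hgs
        exact mul_pos_of_neg_of_neg h1 hgs
      · rw [sign_pos h1, eq_comm, sign_eq_one_iff] at hgs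
        exact mul_pos h1 hgs
    rw [e1, e2]
    have : 0 < (b - a) := sub_pos.mpr hab
    have : 0 < ((m' : K) + 1) * ((k' : K) + 1) * (b - a) ^ 2 * (g.eval a * g.eval b) := by
      positivity
    linarith
  obtain ⟨c, h1, h2, h3⟩ := hK w a b hab hwab
  exact ⟨c, h1, h2, by rw [hder]; simp [h3]⟩

theorem HasPolyIVT.rolle (hK : HasPolyIVT K) (p : K[X]) {a b : K} (hab : a < b)
    (ha : p.eval a = 0) (hb : p.eval b = 0) :
    ∃ c, a < c ∧ c < b ∧ (derivative p).eval c = 0 := by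
  classical
  by_cases hp : p = 0
  · obtain ⟨c, hc⟩ := exists_between hab
    exact ⟨c, hc.1, hc.2, by simp [hp]⟩
  set R := p.roots.toFinset.filter (fun x => a < x) with hR
  have hbR : b ∈ R := by simp [hR, hp, hb, hab]
  set b' := R.min' ⟨b, hbR⟩ with hb'
  have hb'R : b' ∈ R := R.min'_mem _
  have hb'b : b' ≤ b := R.min'_le _ hbR
  simp only [hR, Finset.mem_filter, Multiset.mem_toFinset, mem_roots hp, IsRoot] at hb'R
  obtain ⟨c, h1, h2, h3⟩ := hK.rolle_of_consecutive hb'R.2 hp ha hb'R.1 (fun x hx hx' h0 =>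
    absurd (R.min'_le x (by simp [hR, hp, h0, hx])) (not_le.mpr hx'))
  exact ⟨c, h1, h2.trans_le hb'b, h3⟩

theorem HasPolyIVT.mvt (hK : HasPolyIVT K) (p : K[X]) {a b : K} (hab : a < b) :
    ∃ c, a < c ∧ c < b ∧ p.eval b - p.eval a = (derivative p).eval c * (b - a) := by
  have hne : b - a ≠ 0 := sub_ne_zero.mpr hab.ne'
  obtain ⟨c, h1, h2, h3⟩ := hK.rolle
    (p - C (p.eval a) - C ((p.eval b - p.eval a) / (b - a)) * (X - C a)) hab (by simp)
    (by simp [div_mul_cancel₀ _ hne])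
  refine ⟨c, h1, h2, ?_⟩
  simp [sub_eq_zero] at h3
  rw [h3, div_mul_cancel₀ _ hne]

/-- A polynomial with a root in an interval on which its derivative has no zero
changes sign exactly there. -/
theorem HasPolyIVT.sign_eval_of_root (hK : HasPolyIVT K) (p : K[X]) {u v α x : K}
    (hd : ∀ y, u < y → y < v → (derivative p).eval y ≠ 0) (hu : u < α) (hv : α < v)
    (hα : p.eval α = 0) (hux : u ≤ x) (hxv : x ≤ v) :
    SignType.sign (p.eval x) =
      SignType.sign ((derivative p).eval α) * SignType.sign (x - α) := by
  have key : ∀ c, u < c → c < v →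
      SignType.sign ((derivative p).eval c) = SignType.sign ((derivative p).eval α) :=
    fun c h1 h2 => hK.sign_eval_eq _ (S := Set.Ioo u v) (fun y hy => hd y hy.1 hy.2)
      ⟨h1, h2⟩ ⟨hu, hv⟩
  rcases lt_trichotomy x α with h | rfl | h
  · obtain ⟨c, h1, h2, h3⟩ := hK.mvt p h
    have : p.eval x = (derivative p).eval c * (x - α) := by
      rw [hα] at h3; linear_combination -h3
    rw [this, sign_mul, key c (by order) (by order)]
  · simp [hα]
  · obtain ⟨c, h1, h2, h3⟩ := hK.mvt p h
    have : p.eval x = (derivative p).eval c * (x - α) := by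
      rw [hα] at h3; linear_combination h3
    rw [this, sign_mul, key c (by order) (by order)]

/-- A root of a monic polynomial is bounded in terms of its coefficients. -/
theorem abs_root_le {p : K[X]} (hp : p.Monic) {α : K} (hα : p.eval α = 0) :
    |α| < 2 + ∑ i ∈ Finset.range p.natDegree, (1 + p.coeff i ^ 2) := by
  by_contra! hcon
  set d := p.natDegree with hd
  have hs : 0 ≤ ∑ i ∈ Finset.range d, (1 + p.coeff i ^ 2) :=
    Finset.sum_nonneg fun i _ => by positivity
  have h1 : 1 ≤ |α| := by linarith
  have hd0 : d ≠ 0 := by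
    intro h0
    rw [hp.natDegree_eq_zero.mp h0] at hα
    simp at hα
  rw [eval_eq_sum_range, Finset.sum_range_succ, ← hd, hp.coeff_natDegree, one_mul] at hα
  have h2 : |α| ^ d ≤ ∑ i ∈ Finset.range d, (1 + p.coeff i ^ 2) * |α| ^ (d - 1) := by
    have : α ^ d = -∑ i ∈ Finset.range d, p.coeff i * α ^ i := by linear_combination hα
    rw [← abs_pow, this, abs_neg]
    refine (Finset.abs_sum_le_sum_abs _ _).trans (Finset.sum_le_sum fun i hi => ?_)
    rw [abs_mul, abs_pow]
    have hi' := Finset.mem_range.mp hi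
    gcongr
    · rw [← sq_abs (p.coeff i)]
      nlinarith [sq_nonneg (|p.coeff i| - 1), abs_nonneg (p.coeff i)]
    · omega
  rw [← Finset.sum_mul] at h2
  have h3 : |α| ^ d = |α| * |α| ^ (d - 1) := by
    rw [← pow_succ', Nat.sub_add_cancel (Nat.pos_of_ne_zero hd0)]
  rw [h3] at h2
  have h4 : 0 < |α| ^ (d - 1) := by positivity
  have := le_of_mul_le_mul_right h2 h4
  linarith

end IVT

end

section

open Polynomial

section Pair

variable {A K L : Type} [Field A] [Field K] [Field L] {f : A →+* K} {g : A →+* L}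

/-- All roots, in `K` and in `L`, of nonzero polynomials over `A` of degree `< d` lie in `A`. -/
def RootsBelow (f : A →+* K) (g : A →+* L) (d : ℕ) : Prop :=
  ∀ q : A[X], q ≠ 0 → q.natDegree < d →
    (∀ w, (q.map f).eval w = 0 → ∃ a, f a = w) ∧ (∀ w, (q.map g).eval w = 0 → ∃ a, g a = w)

theorem RootsBelow.swap {d : ℕ} (h : RootsBelow f g d) : RootsBelow g f d :=
  fun q hq hd => (h q hq hd).symm

variable [LinearOrder K] [LinearOrder L]

/-- No pair `(α, β)` outside `A` can be adjoined to the sign-compatible pair `(f, g)`. -/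
def IsMaxPair (f : A →+* K) (g : A →+* L) : Prop :=
  ∀ α β, (∀ q : A[X], SignType.sign ((q.map f).eval α) = SignType.sign ((q.map g).eval β)) →
    ∃ a, f a = α ∧ g a = β

theorem IsMaxPair.swap (h : IsMaxPair f g) : IsMaxPair g f := fun α β hq => by
  obtain ⟨a, h1, h2⟩ := h β α fun q => (hq q).symm
  exact ⟨a, h2, h1⟩

variable [IsStrictOrderedRing K] [IsStrictOrderedRing L]

theorem map_lt_iff_of_sign (hs : ∀ a, SignType.sign (f a) = SignType.sign (g a)) (a b : A) :
    f a < f b ↔ g a < g b := by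
  have := hs (b - a)
  rw [← sub_pos, ← sign_eq_one_iff, ← map_sub, this, sign_eq_one_iff, map_sub, sub_pos]

/-- If the points near `F` realise the cut of `α` over `A`, then they give polynomials over `A`
the same signs as `α`. -/
theorem eventually_sign_eval_eq (hK : HasPolyIVT K) (hL : HasPolyIVT L)
    (hs : ∀ a, SignType.sign (f a) = SignType.sign (g a)) {d : ℕ} (hr : RootsBelow f g d)
    (F : Filter L) (α : K)
    (hcut : ∀ a, ∀ᶠ l in F, SignType.sign (l - g a) = SignType.sign (α - f a))
    (q : A[X]) (hq : q.natDegree < d) :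
    ∀ᶠ l in F, SignType.sign ((q.map g).eval l) = SignType.sign ((q.map f).eval α) := by
  induction hn : q.natDegree using Nat.strong_induction_on generalizing q with
  | _ n ih =>
  by_cases hq0 : q = 0
  · simp [hq0]
  have step : ∀ a, q.eval a = 0 →
      ∀ᶠ l in F, SignType.sign ((q.map g).eval l) = SignType.sign ((q.map f).eval α) := by
    intro a ha
    obtain ⟨r, hqr⟩ := dvd_iff_isRoot.mpr ha
    have hr0 : r ≠ 0 := by rintro rfl; simp at hqr; exact hq0 hqr
    have hdeg : q.natDegree = 1 + r.natDegree := by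
      rw [hqr, natDegree_mul (X_sub_C_ne_zero a) hr0, natDegree_X_sub_C]
    filter_upwards [ih r.natDegree (by omega) r (by omega) rfl, hcut a] with l h1 h2
    rw [hqr]
    simp [sign_mul, h1, h2]
  by_cases h1 : ∃ w, (q.map f).eval w = 0
  · obtain ⟨w, hw⟩ := h1
    obtain ⟨a, rfl⟩ := (hr q hq0 hq).1 w hw
    rw [eval_map_apply, map_eq_zero] at hw
    exact step a hw
  by_cases h2 : ∃ w, (q.map g).eval w = 0
  · obtain ⟨w, hw⟩ := h2
    obtain ⟨a, rfl⟩ := (hr q hq0 hq).2 w hw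
    rw [eval_map_apply, map_eq_zero] at hw
    exact step a hw
  push Not at h1 h2
  refine Filter.Eventually.of_forall fun l => ?_
  rw [hK.sign_eval_eq (q.map f) (S := Set.univ) (fun x _ => h1 x) (Set.mem_univ α)
      (Set.mem_univ (f 0)),
    hL.sign_eval_eq (q.map g) (S := Set.univ) (fun x _ => h2 x) (Set.mem_univ l)
      (Set.mem_univ (g 0)), eval_map_apply, eval_map_apply, hs]

theorem IsMaxPair.exists_of_root_aux (hm : IsMaxPair f g) (hK : HasPolyIVT K) (hL : HasPolyIVT L)
    (hs : ∀ a, SignType.sign (f a) = SignType.sign (g a)) {d : ℕ} (hr : RootsBelow f g d)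
    (p : A[X]) (hp : p.Monic) (hd : p.natDegree = d) (α : K) (hα : (p.map f).eval α = 0) :
    ∃ a, f a = α := by
  classical
  by_contra hcon
  have hlt := map_lt_iff_of_sign hs
  have hne : ∀ a, f a ≠ α := fun a ha => hcon ⟨a, ha⟩
  have : CharZero A := f.charZero
  have hd0 : p.natDegree ≠ 0 := by
    intro h0
    rw [hp.natDegree_eq_zero.mp h0] at hα
    simp at hα
  have hdd : (derivative p).natDegree < d := hd ▸ natDegree_derivative_lt hd0
  have hd1 : derivative p ≠ 0 := by
    intro h0
    exact hd0 (derivative_eq_zero.mp h0)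
  set B : A := 2 + ∑ i ∈ Finset.range p.natDegree, (1 + p.coeff i ^ 2) with hB
  have hαB : |α| < f B := by
    have := abs_root_le (hp.map f) hα
    simpa [hB, map_ofNat f 2] using this
  rw [abs_lt] at hαB
  set R := (derivative p).roots.toFinset with hR
  have memR : ∀ a, a ∈ R ↔ (derivative p).eval a = 0 := fun a => by simp [hR, hd1]
  obtain ⟨u, hu, humax⟩ := Finset.exists_max_image (insert (-B) (R.filter (fun a => f a < α))) f
    ⟨-B, by simp⟩
  obtain ⟨v, hv, hvmin⟩ := Finset.exists_min_image (insert B (R.filter (fun a => α < f a))) f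
    ⟨B, by simp⟩
  have huα : f u < α := by
    rcases Finset.mem_insert.mp hu with rfl | h
    · simpa using hαB.1
    · exact (Finset.mem_filter.mp h).2
  have hvα : α < f v := by
    rcases Finset.mem_insert.mp hv with rfl | h
    · exact hαB.2
    · exact (Finset.mem_filter.mp h).2
  have hnoA : ∀ a, f u < f a → f a < f v → (derivative p).eval a ≠ 0 := by
    intro a h1 h2 h0
    rcases lt_or_gt_of_ne (hne a) with h | h
    · exact absurd (humax a (by simp [memR, h0, h])) (not_le.mpr h1)
    · exact absurd (hvmin a (by simp [memR, h0, h])) (not_le.mpr h2)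
  have hnoK : ∀ y, f u < y → y < f v → (derivative (p.map f)).eval y ≠ 0 := by
    intro y h1 h2 h0
    rw [derivative_map] at h0
    obtain ⟨a, rfl⟩ := (hr _ hd1 hdd).1 y h0
    rw [eval_map_apply, map_eq_zero] at h0
    exact hnoA a h1 h2 h0
  have hnoL : ∀ y, g u < y → y < g v → (derivative (p.map g)).eval y ≠ 0 := by
    intro y h1 h2 h0
    rw [derivative_map] at h0
    obtain ⟨a, rfl⟩ := (hr _ hd1 hdd).2 y h0
    rw [eval_map_apply, map_eq_zero] at h0
    exact hnoA a ((hlt _ _).2 h1) ((hlt _ _).2 h2) h0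
  have huv : f u < f v := huα.trans hvα
  set s := SignType.sign ((derivative (p.map f)).eval α) with hsdef
  have hs0 : s ≠ 0 := by
    rw [hsdef, Ne, sign_eq_zero_iff]
    exact hnoK α huα hvα
  have sK : ∀ a, f u ≤ f a → f a ≤ f v →
      SignType.sign ((p.map f).eval (f a)) = s * SignType.sign (f a - α) :=
    fun a h1 h2 => hK.sign_eval_of_root _ hnoK huα hvα hα h1 h2
  have sKL : ∀ a, SignType.sign ((p.map g).eval (g a)) = SignType.sign ((p.map f).eval (f a)) := by
    intro a
    rw [eval_map_apply, eval_map_apply, hs]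
  have hsu : SignType.sign ((p.map g).eval (g u)) = -s := by
    rw [sKL, sK u le_rfl huv.le, sign_neg (sub_neg.mpr huα), mul_neg_one]
  have hsv : SignType.sign ((p.map g).eval (g v)) = s := by
    rw [sKL, sK v huv.le le_rfl, sign_pos (sub_pos.mpr hvα), mul_one]
  obtain ⟨β, hβ1, hβ2, hβ⟩ := hL (p.map g) (g u) (g v) ((hlt _ _).1 huv) (by
    rw [← sign_eq_neg_one_iff, sign_mul, hsu, hsv]
    revert hs0
    generalize s = s
    revert s
    decide)
  have sL : ∀ a, g u ≤ g a → g a ≤ g v → SignType.sign ((p.map g).eval (g a)) =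
      SignType.sign ((derivative (p.map g)).eval β) * SignType.sign (g a - β) :=
    fun a h1 h2 => hL.sign_eval_of_root _ hnoL hβ1 hβ2 hβ h1 h2
  have hs' : SignType.sign ((derivative (p.map g)).eval β) = s := by
    have := sL v ((hlt _ _).1 huv).le le_rfl
    rw [hsv, sign_pos (sub_pos.mpr hβ2), mul_one] at this
    exact this.symm
  have hcut : ∀ a, SignType.sign (β - g a) = SignType.sign (α - f a) := by
    intro a
    rcases lt_or_ge (f a) (f u) with h1 | h1
    · have h2 := (hlt _ _).1 h1
      rw [sign_pos (sub_pos.mpr (h1.trans huα)), sign_pos (sub_pos.mpr (h2.trans hβ1))]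
    rcases lt_or_ge (f v) (f a) with h2 | h2
    · have h3 := (hlt _ _).1 h2
      rw [sign_neg (sub_neg.mpr (hvα.trans h2)), sign_neg (sub_neg.mpr (hβ2.trans h3))]
    have e1 := sK a h1 h2
    have e2 := sL a (not_lt.mp fun h => not_lt.mpr h1 ((hlt _ _).2 h))
      (not_lt.mp fun h => not_lt.mpr h2 ((hlt _ _).2 h))
    rw [sKL, e1, hs'] at e2
    rw [← neg_sub (g a) β, ← neg_sub (f a) α, Left.sign_neg, Left.sign_neg]
    revert hs0 e2
    generalize s = s, SignType.sign (g a - β) = x, SignType.sign (f a - α) = y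
    revert s x y
    decide
  have hsmall : ∀ q : A[X], q.natDegree < d →
      SignType.sign ((q.map g).eval β) = SignType.sign ((q.map f).eval α) := fun q hq =>
    eventually_sign_eval_eq hK hL hs hr (pure β) α hcut q hq
  obtain ⟨a, ha, -⟩ := hm α β fun q => by
    have h1 := hsmall (q %ₘ p) (hd ▸ natDegree_modByMonic_lt q hp (by rintro rfl; simp at hd0))
    have h2 := congrArg (fun r => (r.map f).eval α) (modByMonic_add_div q p)
    have h3 := congrArg (fun r => (r.map g).eval β) (modByMonic_add_div q p)
    simp only [Polynomial.map_add, Polynomial.map_mul, eval_add, eval_mul, hα, hβ, zero_mul,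
      add_zero] at h2 h3
    rw [← h2, ← h3, h1]
  exact hcon ⟨a, ha⟩

theorem IsMaxPair.rootsBelow (hm : IsMaxPair f g) (hK : HasPolyIVT K) (hL : HasPolyIVT L)
    (hs : ∀ a, SignType.sign (f a) = SignType.sign (g a)) (d : ℕ) : RootsBelow f g d := by
  induction d with
  | zero => exact fun q _ h => absurd h (Nat.not_lt_zero _)
  | succ d ih =>
    intro q hq hqd
    have hd : (C q.leadingCoeff⁻¹ * q).natDegree < d ∨ (C q.leadingCoeff⁻¹ * q).natDegree = d := by
      rw [natDegree_C_mul (by simpa using hq)]; omega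
    have hmon : (C q.leadingCoeff⁻¹ * q).Monic := by
      rw [mul_comm]; exact monic_mul_leadingCoeff_inv hq
    rcases hd with hd | hd
    · exact ih q hq (by rwa [natDegree_C_mul (by simpa using hq)] at hd)
    · exact ⟨fun w hw => hm.exists_of_root_aux hK hL hs ih _ hmon hd w (by simp [hw]),
        fun w hw => hm.swap.exists_of_root_aux hL hK (fun a => (hs a).symm) ih.swap _ hmon hd w
          (by simp [hw])⟩

end Pair

end

section

open Polynomial

section SignCompat

variable {K L : Type} [Field K] [LinearOrder K] [Field L] [LinearOrder L]

/-- Corresponding elements of a subring of `K × L` have the same sign. -/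
def SignCompat (T : Subring (K × L)) : Prop :=
  ∀ z ∈ T, SignType.sign z.1 = SignType.sign z.2

theorem SignCompat.exists_maximal {T : Subring (K × L)} (hT : SignCompat T) :
    ∃ M, T ≤ M ∧ Maximal SignCompat M := by
  refine zorn_le_nonempty₀ {T : Subring (K × L) | SignCompat T} ?_ T hT
  intro c hc hchain y hy
  refine ⟨sSup c, ?_, fun z hz => le_sSup hz⟩
  intro z hz
  obtain ⟨S, hS, hzS⟩ := (Subring.mem_sSup_of_directedOn ⟨y, hy⟩ hchain.directedOn).mp hz
  exact hc hS z hzS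

theorem signCompat_range_prod {A : Type} [CommRing A] {f : A →+* K} {g : A →+* L}
    (h : ∀ a, SignType.sign (f a) = SignType.sign (g a)) : SignCompat (f.prod g).range := by
  rintro _ ⟨a, rfl⟩
  exact h a

variable [IsStrictOrderedRing K] [IsStrictOrderedRing L]

theorem isField_of_maximal_signCompat {M : Subring (K × L)} (hM : Maximal SignCompat M) :
    IsField M := by
  have hzero : ∀ z ∈ M, z.1 = 0 → z.2 = 0 := fun z hz h0 => by
    have := hM.1 z hz
    rwa [h0, sign_zero, eq_comm, sign_eq_zero_iff] at this
  let S : Subring (K × L) :=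
    { carrier := {z | ∃ t ∈ M, t.1 ≠ 0 ∧ z * t ∈ M}
      mul_mem' := by
        rintro z w ⟨t, ht, ht0, hzt⟩ ⟨s, hs, hs0, hws⟩
        refine ⟨t * s, M.mul_mem ht hs, mul_ne_zero ht0 hs0, ?_⟩
        rw [mul_mul_mul_comm]
        exact M.mul_mem hzt hws
      one_mem' := ⟨1, M.one_mem, one_ne_zero, by simp [M.one_mem]⟩
      add_mem' := by
        rintro z w ⟨t, ht, ht0, hzt⟩ ⟨s, hs, hs0, hws⟩
        refine ⟨t * s, M.mul_mem ht hs, mul_ne_zero ht0 hs0, ?_⟩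
        have : (z + w) * (t * s) = z * t * s + w * s * t := by ring
        rw [this]
        exact M.add_mem (M.mul_mem hzt hs) (M.mul_mem hws ht)
      zero_mem' := ⟨1, M.one_mem, one_ne_zero, by simp [M.zero_mem]⟩
      neg_mem' := by
        rintro z ⟨t, ht, ht0, hzt⟩
        exact ⟨t, ht, ht0, by rw [neg_mul]; exact M.neg_mem hzt⟩ }
  have hS : SignCompat S := by
    rintro z ⟨t, ht, ht0, hzt⟩
    have h1 := hM.1 _ hzt
    have h2 := hM.1 _ ht
    rw [Prod.fst_mul, Prod.snd_mul, sign_mul, sign_mul, ← h2] at h1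
    have h3 : SignType.sign t.1 ≠ 0 := by rwa [Ne, sign_eq_zero_iff]
    revert h1 h3
    generalize SignType.sign t.1 = a, SignType.sign z.1 = b, SignType.sign z.2 = c
    revert a b c
    decide
  have hMS : M ≤ S := fun z hz => ⟨1, M.one_mem, one_ne_zero, by simpa using hz⟩
  have hSM : S ≤ M := hM.2 hS hMS
  refine ⟨⟨0, 1, zero_ne_one⟩, mul_comm, ?_⟩
  rintro ⟨z, hz⟩ hz0
  have h1 : z.1 ≠ 0 := fun h => hz0 (Subtype.ext (Prod.ext h (hzero z hz h)))
  have h2 : z.2 ≠ 0 := by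
    have := hM.1 z hz
    intro h
    rw [h, sign_zero, sign_eq_zero_iff] at this
    exact h1 this
  have h3 : ((z.1)⁻¹, (z.2)⁻¹) * z = 1 := Prod.ext (inv_mul_cancel₀ h1) (inv_mul_cancel₀ h2)
  refine ⟨⟨((z.1)⁻¹, (z.2)⁻¹), hSM ⟨z, hz, h1, by rw [h3]; exact M.one_mem⟩⟩, Subtype.ext ?_⟩
  rw [mul_comm]
  exact h3

end SignCompat

section Germ

open Filter

variable {I L : Type} [Field L] {U : Ultrafilter I}

/-- Constant germs. -/
noncomputable def germConst (U : Ultrafilter I) (L : Type) [Field L] :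
    L →+* Germ (U : Filter I) L :=
  (Germ.coeRingHom _).comp (Pi.constRingHom I L)

theorem germ_eval_map (p : L[X]) (h : I → L) :
    (p.map (germConst U L)).eval (h : Germ (U : Filter I) L) =
      ((fun i => p.eval (h i) : I → L) : Germ (U : Filter I) L) := by
  induction p using Polynomial.induction_on' with
  | add p q hp hq => simp only [Polynomial.map_add, eval_add, hp, hq]; rfl
  | monomial n a => simp only [map_monomial, eval_monomial]; rfl

theorem germ_polynomial_lift (p : (Germ (U : Filter I) L)[X]) :
    ∃ P : I → L[X], ∀ h : I → L,
      p.eval (h : Germ (U : Filter I) L) = ((fun i => (P i).eval (h i) : I → L) :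
        Germ (U : Filter I) L) := by
  induction p using Polynomial.induction_on' with
  | add p q hp hq =>
    obtain ⟨P, hP⟩ := hp
    obtain ⟨Q, hQ⟩ := hq
    refine ⟨fun i => P i + Q i, fun h => ?_⟩
    simp only [eval_add, hP, hQ]; rfl
  | monomial n a =>
    induction a using Germ.inductionOn with
    | _ a =>
    refine ⟨fun i => monomial n (a i), fun h => ?_⟩
    simp only [eval_monomial]; rfl

variable [LinearOrder L]

theorem germ_sign {h : I → L} {s : SignType}
    (hs : ∀ᶠ i in (U : Filter I), SignType.sign (h i) = s) :
    SignType.sign (h : Germ (U : Filter I) L) = s := by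
  rcases s with _ | _ | _
  · exact sign_eq_zero_iff.mpr (Germ.coe_eq.mpr (hs.mono fun i hi => sign_eq_zero_iff.mp hi))
  · exact sign_eq_neg_one_iff.mpr (Germ.coe_lt.mpr (hs.mono fun i hi => sign_eq_neg_one_iff.mp hi))
  · exact sign_eq_one_iff.mpr (Germ.coe_lt.mpr (hs.mono fun i hi => sign_eq_one_iff.mp hi))

theorem HasPolyIVT.germ (hL : HasPolyIVT L) : HasPolyIVT (Germ (U : Filter I) L) := by
  classical
  intro p a b hab hp
  obtain ⟨P, hP⟩ := germ_polynomial_lift p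
  induction a using Germ.inductionOn with
  | _ a =>
  induction b using Germ.inductionOn with
  | _ b =>
  rw [hP, hP] at hp
  have h1 := Germ.coe_lt.mp hab
  have h2 : ∀ᶠ i in (U : Filter I), (P i).eval (a i) * (P i).eval (b i) < 0 := Germ.coe_lt.mp hp
  have h3 : ∀ i, ∃ c, a i < b i → (P i).eval (a i) * (P i).eval (b i) < 0 →
      a i < c ∧ c < b i ∧ (P i).eval c = 0 := by
    intro i
    by_cases hi : a i < b i ∧ (P i).eval (a i) * (P i).eval (b i) < 0
    · obtain ⟨c, hc⟩ := hL (P i) (a i) (b i) hi.1 hi.2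
      exact ⟨c, fun _ _ => hc⟩
    · exact ⟨0, fun h h' => absurd ⟨h, h'⟩ hi⟩
  choose c hc using h3
  have h4 := h1.and h2
  refine ⟨(c : Germ (U : Filter I) L), Germ.coe_lt.mpr (h4.mono fun i hi => (hc i hi.1 hi.2).1),
    Germ.coe_lt.mpr (h4.mono fun i hi => (hc i hi.1 hi.2).2.1), ?_⟩
  rw [hP]
  exact Germ.coe_eq.mpr (h4.mono fun i hi => (hc i hi.1 hi.2).2.2)

end Germ

section Extend

open Filter

variable {K L : Type} [Field K] [LinearOrder K] [IsStrictOrderedRing K]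
  [Field L] [LinearOrder L] [IsStrictOrderedRing L]

/-- Every cut of an ordered subfield is realised in a suitable ultrapower. -/
theorem exists_ultrafilter_cut {A : Type} [Field A] {f : A →+* K} {g : A →+* L}
    (hs : ∀ a, SignType.sign (f a) = SignType.sign (g a)) (α : K) :
    ∃ U : Ultrafilter L, ∀ a, ∀ᶠ l in (U : Filter L),
      SignType.sign (l - g a) = SignType.sign (α - f a) := by
  classical
  have hlt := map_lt_iff_of_sign hs
  obtain ⟨U, hU⟩ := Ultrafilter.exists_ultrafilter_of_finite_inter_nonempty
    (Set.range fun a => {l : L | SignType.sign (l - g a) = SignType.sign (α - f a)}) (by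
    intro T hT
    obtain ⟨R, hR⟩ : ∃ R : Finset A, T ⊆
        R.image (fun a => {l : L | SignType.sign (l - g a) = SignType.sign (α - f a)}) := by
      rw [← Set.image_univ] at hT
      obtain ⟨R, -, hR⟩ := Finset.subset_set_image_iff.mp hT
      exact ⟨R, hR.ge⟩
    suffices h : ∃ l, ∀ a ∈ R, SignType.sign (l - g a) = SignType.sign (α - f a) by
      obtain ⟨l, hl⟩ := h
      refine ⟨l, Set.mem_sInter.mpr fun s hsT => ?_⟩
      obtain ⟨a, ha, rfl⟩ := Finset.mem_image.mp (hR hsT)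
      exact hl a ha
    by_cases hα : ∃ a, f a = α
    · obtain ⟨a, rfl⟩ := hα
      exact ⟨g a, fun b _ => by rw [← map_sub, ← map_sub, hs]⟩
    · obtain ⟨l, hl1, hl2⟩ := Order.exists_between_finsets
        (lo := (R.filter (fun a => f a < α)).image g) (hi := (R.filter (fun a => α < f a)).image g)
        (by
          intro x hx y hy
          obtain ⟨a, ha, rfl⟩ := Finset.mem_image.mp hx
          obtain ⟨b, hb, rfl⟩ := Finset.mem_image.mp hy
          exact (hlt a b).mp ((Finset.mem_filter.mp ha).2.trans (Finset.mem_filter.mp hb).2))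
      refine ⟨l, fun a ha => ?_⟩
      rcases lt_trichotomy (f a) α with h | h | h
      · rw [sign_pos (sub_pos.mpr h), sign_pos (sub_pos.mpr (hl1 _ (Finset.mem_image_of_mem g
          (Finset.mem_filter.mpr ⟨ha, h⟩))))]
      · exact absurd ⟨a, h⟩ hα
      · rw [sign_neg (sub_neg.mpr h), sign_neg (sub_neg.mpr (hl2 _ (Finset.mem_image_of_mem g
          (Finset.mem_filter.mpr ⟨ha, h⟩))))])
  exact ⟨U, fun a => hU ⟨a, rfl⟩⟩

theorem SignCompat.exists_extend {T : Subring (K × L)} (hT : SignCompat T) (hK : HasPolyIVT K)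
    (hL : HasPolyIVT L) (α : K) :
    ∃ (U : Ultrafilter L) (T' : Subring (K × Germ (U : Filter L) L)), SignCompat T' ∧
      (∀ z ∈ T, (z.1, germConst U L z.2) ∈ T') ∧ ∃ β, (α, β) ∈ T' := by
  obtain ⟨M, hTM, hM⟩ := hT.exists_maximal
  let : Field M := (isField_of_maximal_signCompat hM).toField
  let f : M →+* K := (RingHom.fst K L).comp M.subtype
  let g : M →+* L := (RingHom.snd K L).comp M.subtype
  have hs : ∀ a, SignType.sign (f a) = SignType.sign (g a) := fun a => hM.1 a a.2
  have hmax : IsMaxPair f g := by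
    intro α β hq
    let Φ : M[X] →+* K × L := (eval₂RingHom f α).prod (eval₂RingHom g β)
    have h1 : SignCompat Φ.range := signCompat_range_prod fun q => by
      have h := hq q
      rwa [eval_map, eval_map] at h
    have h2 : M ≤ Φ.range := fun z hz => ⟨C ⟨z, hz⟩, by simp [Φ, f, g]⟩
    have h3 : (α, β) ∈ M := hM.2 h1 h2 ⟨X, by simp [Φ]⟩
    exact ⟨⟨(α, β), h3⟩, rfl, rfl⟩
  obtain ⟨U, hU⟩ := exists_ultrafilter_cut hs α
  refine ⟨U, ((eval₂RingHom f α).prod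
    (eval₂RingHom ((germConst U L).comp g) ((fun l => l : L → L) : Germ (U : Filter L) L))).range,
    signCompat_range_prod fun q => ?_, fun z hz => ⟨C ⟨z, hTM hz⟩, by simp [f, g]⟩, _,
    ⟨X, by simp; rfl⟩⟩
  have h := eventually_sign_eval_eq hK hL hs (hmax.rootsBelow hK hL hs (q.natDegree + 1)) U α hU q
    (Nat.lt_succ_self _)
  simp only [coe_eval₂RingHom]
  rw [← eval_map, ← eval_map, ← Polynomial.map_map g, germ_eval_map]
  exact (germ_sign h).symm

end Extend

end

section

open Polynomial

theorem hasPolyIVT_real : HasPolyIVT ℝ := by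
  intro p a b hab h
  have hc : ContinuousOn (fun x => p.eval x) (Set.uIcc a b) := p.continuous.continuousOn
  have h0 : (0 : ℝ) ∈ Set.uIcc (p.eval a) (p.eval b) := by
    rw [Set.mem_uIcc]
    rcases mul_neg_iff.mp h with ⟨h1, h2⟩ | ⟨h1, h2⟩
    · exact Or.inr ⟨h2.le, h1.le⟩
    · exact Or.inl ⟨h1.le, h2.le⟩
  obtain ⟨c, hc1, hc2⟩ := intermediate_value_uIcc hc h0
  rw [Set.uIcc_of_le hab.le] at hc1
  refine ⟨c, lt_of_le_of_ne hc1.1 ?_, lt_of_le_of_ne hc1.2 ?_, hc2⟩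
  · rintro rfl
    simp only at hc2
    rw [hc2, zero_mul] at h
    exact lt_irrefl _ h
  · rintro rfl
    simp only at hc2
    rw [hc2, mul_zero] at h
    exact lt_irrefl _ h

section Transfer

open Filter

/-- Points over `L` satisfying one equation and one inequation over `ℝ` descend to `ℝ`. -/
def DescendsToReal {L : Type} [Field L] (ι : ℝ →+* L) (n : ℕ) : Prop :=
  ∀ (g f : MvPolynomial (Fin n) ℝ) (y : Fin n → L), MvPolynomial.eval₂ ι y g = 0 →
    MvPolynomial.eval₂ ι y f ≠ 0 →
      ∃ a : Fin n → ℝ, MvPolynomial.eval a g = 0 ∧ MvPolynomial.eval a f ≠ 0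

theorem germ_mvPolynomial_eval₂ {I L : Type} [Field L] {U : Ultrafilter I} {n : ℕ} (ι : ℝ →+* L)
    (p : MvPolynomial (Fin n) ℝ) (y : Fin n → I → L) :
    MvPolynomial.eval₂ ((germConst U L).comp ι) (fun j => (y j : Germ (U : Filter I) L)) p =
      ((fun i => MvPolynomial.eval₂ ι (fun j => y j i) p : I → L) : Germ (U : Filter I) L) := by
  induction p using MvPolynomial.induction_on with
  | C a => simp only [MvPolynomial.eval₂_C]; rfl
  | add p q hp hq => simp only [MvPolynomial.eval₂_add, hp, hq]; rfl
  | mul_X p j hp => simp only [MvPolynomial.eval₂_mul, MvPolynomial.eval₂_X, hp]; rfl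

theorem DescendsToReal.germ {I L : Type} [Field L] {ι : ℝ →+* L} {n : ℕ}
    (h : DescendsToReal ι n) (U : Ultrafilter I) :
    DescendsToReal ((germConst U L).comp ι) n := by
  intro g f y hg hf
  obtain ⟨y, rfl⟩ : ∃ z : Fin n → I → L, y = fun j => (z j : Germ (U : Filter I) L) := by
    choose z hz using fun j => Quotient.exists_rep (y j)
    exact ⟨z, funext fun j => (hz j).symm⟩
  rw [germ_mvPolynomial_eval₂] at hg hf
  have h1 := Germ.coe_eq.mp hg
  have h2 : ∃ᶠ i in (U : Filter I), MvPolynomial.eval₂ ι (fun j => y j i) f ≠ 0 := by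
    intro hcon
    exact hf (Germ.coe_eq.mpr (hcon.mono fun i hi => not_not.mp hi))
  obtain ⟨i, hi2, hi1⟩ := (h2.and_eventually h1).exists
  exact h g f _ hi1 hi2

variable {K : Type} [Field K] [LinearOrder K] [IsStrictOrderedRing K]

theorem sign_map_real (φ : ℝ →+* K) (r : ℝ) : SignType.sign (φ r) = SignType.sign r := by
  have key : ∀ r : ℝ, 0 < r → 0 < φ r := by
    intro r hr
    rw [← Real.mul_self_sqrt hr.le, map_mul]
    exact mul_self_pos.mpr ((map_ne_zero φ).mpr (Real.sqrt_pos.mpr hr).ne')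
  rcases lt_trichotomy r 0 with h | rfl | h
  · rw [sign_neg h, sign_eq_neg_one_iff]
    simpa using key (-r) (neg_pos.mpr h)
  · simp
  · rw [sign_pos h, sign_eq_one_iff]
    exact key r h

theorem exists_compatible_extension (hK : HasPolyIVT K) (φ : ℝ →+* K) {n : ℕ} (x : Fin n → K)
    (S : Finset (Fin n)) :
    ∃ (L : Type) (_ : Field L) (_ : LinearOrder L) (_ : IsStrictOrderedRing L) (ι : ℝ →+* L)
      (T : Subring (K × L)), HasPolyIVT L ∧ DescendsToReal ι n ∧ SignCompat T ∧
        (∀ r, (φ r, ι r) ∈ T) ∧ ∀ i ∈ S, ∃ y, (x i, y) ∈ T := by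
  classical
  induction S using Finset.induction_on with
  | empty =>
    refine ⟨ℝ, inferInstance, inferInstance, inferInstance, RingHom.id ℝ,
      (φ.prod (RingHom.id ℝ)).range, hasPolyIVT_real, ?_,
      signCompat_range_prod fun r => sign_map_real φ r, fun r => ⟨r, rfl⟩, by simp⟩
    exact fun g f y hg hf => ⟨y, hg, hf⟩
  | insert i S _ ih =>
    obtain ⟨L, _, _, _, ι, T, hL, hd, hT, hφ, hx⟩ := ih
    obtain ⟨U, T', hT', hTT', hβ⟩ := hT.exists_extend hK hL (x i)
    refine ⟨Germ (U : Filter L) L, inferInstance, inferInstance, inferInstance,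
      (germConst U L).comp ι, T', hL.germ, hd.germ U, hT', fun r => hTT' _ (hφ r), ?_⟩
    intro j hj
    rcases Finset.mem_insert.mp hj with rfl | hj
    · exact hβ
    · obtain ⟨y, hy⟩ := hx j hj
      exact ⟨_, hTT' _ hy⟩

/-- A version of the Artin–Lang homomorphism theorem. -/
theorem exists_real_point (hK : HasPolyIVT K) {n : ℕ} (χ : MvPolynomial (Fin n) ℝ →+* K)
    {g f : MvPolynomial (Fin n) ℝ} (hg : χ g = 0) (hf : χ f ≠ 0) :
    ∃ a : Fin n → ℝ, MvPolynomial.eval a g = 0 ∧ MvPolynomial.eval a f ≠ 0 := by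
  obtain ⟨L, _, _, _, ι, T, hL, hd, hT, hφ, hx⟩ := exists_compatible_extension hK
    (χ.comp MvPolynomial.C) (fun i => χ (MvPolynomial.X i)) Finset.univ
  choose y hy using fun i => hx i (Finset.mem_univ i)
  have key : ∀ p : MvPolynomial (Fin n) ℝ, (χ p, MvPolynomial.eval₂ ι y p) ∈ T := by
    intro p
    induction p using MvPolynomial.induction_on with
    | C a => simpa using hφ a
    | add p q hp hq => simpa using T.add_mem hp hq
    | mul_X p j hp => simpa using T.mul_mem hp (hy j)
  have hs : ∀ p, SignType.sign (χ p) = SignType.sign (MvPolynomial.eval₂ ι y p) :=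
    fun p => hT _ (key p)
  refine hd g f y ?_ ?_
  · rw [← sign_eq_zero_iff, ← hs, hg, sign_zero]
  · rwa [Ne, ← sign_eq_zero_iff, ← hs, sign_eq_zero_iff]

end Transfer

end

section

open Polynomial

variable {Ω : Type} [Field Ω]

/-- A subsemiring which is the nonnegative part of a partial order on the subring it spans and
contains all squares of that subring. -/
structure IsSquareCone (P : Subsemiring Ω) : Prop where
  sub_sq_mem : ∀ x ∈ P, ∀ y ∈ P, (x - y) ^ 2 ∈ P
  eq_zero : ∀ x ∈ P, -x ∈ P → x = 0

theorem IsSquareCone.exists_maximal {P₀ : Subsemiring Ω} (h₀ : IsSquareCone P₀) :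
    ∃ P, P₀ ≤ P ∧ Maximal IsSquareCone P := by
  refine zorn_le_nonempty₀ {P | IsSquareCone P} (fun c hc hchain Q hQ => ?_) P₀ h₀
  have hmem : ∀ x, x ∈ sSup c ↔ ∃ S ∈ c, x ∈ S := fun x =>
    Subsemiring.mem_sSup_of_directedOn ⟨Q, hQ⟩ hchain.directedOn
  refine ⟨sSup c, ⟨fun x hx y hy => ?_, fun x hx hx' => ?_⟩, fun S hS => le_sSup hS⟩
  · obtain ⟨S, hS, hxS⟩ := (hmem x).1 hx
    obtain ⟨T, hT, hyT⟩ := (hmem y).1 hy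
    obtain ⟨U, hU, hSU, hTU⟩ := hchain.directedOn S hS T hT
    exact (hmem _).2 ⟨U, hU, (hc hU).sub_sq_mem x (hSU hxS) y (hTU hyT)⟩
  · obtain ⟨S, hS, hxS⟩ := (hmem x).1 hx
    obtain ⟨T, hT, hyT⟩ := (hmem (-x)).1 hx'
    obtain ⟨U, hU, hSU, hTU⟩ := hchain.directedOn S hS T hT
    exact (hc hU).eq_zero x (hSU hxS) (hTU hyT)

variable {P : Subsemiring Ω}

theorem inv_mem_of_maximal_isSquareCone (hP : Maximal IsSquareCone P) {x : Ω} (hx : x ∈ P) :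
    x⁻¹ ∈ P := by
  rcases eq_or_ne x 0 with rfl | hx0
  · simp
  let P' : Subsemiring Ω :=
    { carrier := {z | ∃ t ∈ P, t ≠ 0 ∧ z * t ∈ P}
      mul_mem' := by
        rintro z w ⟨t, ht, ht0, h⟩ ⟨s, hs, hs0, h'⟩
        refine ⟨t * s, mul_mem ht hs, mul_ne_zero ht0 hs0, ?_⟩
        rw [mul_mul_mul_comm]
        exact mul_mem h h'
      one_mem' := ⟨1, one_mem P, one_ne_zero, by simp⟩
      add_mem' := by
        rintro z w ⟨t, ht, ht0, h⟩ ⟨s, hs, hs0, h'⟩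
        refine ⟨t * s, mul_mem ht hs, mul_ne_zero ht0 hs0, ?_⟩
        have : (z + w) * (t * s) = z * t * s + w * s * t := by ring
        rw [this]
        exact add_mem (mul_mem h hs) (mul_mem h' ht)
      zero_mem' := ⟨1, one_mem P, one_ne_zero, by simp⟩ }
  have hP' : IsSquareCone P' := by
    refine ⟨?_, ?_⟩
    · rintro z ⟨t, ht, ht0, h⟩ w ⟨s, hs, hs0, h'⟩
      refine ⟨(t * s) ^ 2, pow_mem (mul_mem ht hs) 2, pow_ne_zero _ (mul_ne_zero ht0 hs0), ?_⟩
      have : (z - w) ^ 2 * (t * s) ^ 2 = (z * t * s - w * s * t) ^ 2 := by ring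
      rw [this]
      exact hP.prop.sub_sq_mem _ (mul_mem h hs) _ (mul_mem h' ht)
    · rintro z ⟨t, ht, ht0, h⟩ ⟨s, hs, hs0, h'⟩
      have h1 : z * t * s = 0 := by
        refine hP.prop.eq_zero _ (mul_mem h hs) ?_
        have : -(z * t * s) = -z * s * t := by ring
        rw [this]
        exact mul_mem h' ht
      simpa [ht0, hs0] using h1
  have hle : P ≤ P' := fun z hz => ⟨1, one_mem P, one_ne_zero, by simpa using hz⟩
  exact hP.le_of_ge hP' hle ⟨x, hx, hx0, by simp [hx0]⟩

theorem mem_or_neg_mem_of_maximal_isSquareCone (hP : Maximal IsSquareCone P) {a b : Ω}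
    (ha : a ∈ P) (hb : b ∈ P) : a - b ∈ P ∨ -(a - b) ∈ P := by
  by_contra! hcon
  obtain ⟨hx, hnx⟩ := hcon
  apply hnx
  have hsq := hP.prop.sub_sq_mem a ha b hb
  let P' : Subsemiring Ω :=
    { carrier := {z | ∃ p ∈ P, ∃ q ∈ P, z = p - q * (a - b)}
      mul_mem' := by
        rintro z w ⟨p, hp, q, hq, rfl⟩ ⟨p', hp', q', hq', rfl⟩
        exact ⟨p * p' + q * q' * (a - b) ^ 2,
          add_mem (mul_mem hp hp') (mul_mem (mul_mem hq hq') hsq), p * q' + p' * q,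
          add_mem (mul_mem hp hq') (mul_mem hp' hq), by ring⟩
      one_mem' := ⟨1, one_mem P, 0, zero_mem P, by simp⟩
      add_mem' := by
        rintro z w ⟨p, hp, q, hq, rfl⟩ ⟨p', hp', q', hq', rfl⟩
        exact ⟨p + p', add_mem hp hp', q + q', add_mem hq hq', by ring⟩
      zero_mem' := ⟨0, zero_mem P, 0, zero_mem P, by simp⟩ }
  have hle : P ≤ P' := fun z hz => ⟨z, hz, 0, zero_mem P, by simp⟩
  have hP' : IsSquareCone P' := by
    refine ⟨?_, ?_⟩
    · rintro z ⟨p, hp, q, hq, rfl⟩ w ⟨p', hp', q', hq', rfl⟩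
      have : (p - q * (a - b) - (p' - q' * (a - b))) ^ 2
          = ((p + q * b + q' * a) - (p' + q' * b + q * a)) ^ 2 := by ring
      rw [this]
      exact hle (hP.prop.sub_sq_mem _
        (add_mem (add_mem hp (mul_mem hq hb)) (mul_mem hq' ha)) _
        (add_mem (add_mem hp' (mul_mem hq' hb)) (mul_mem hq ha)))
    · rintro z ⟨p, hp, q, hq, rfl⟩ ⟨p', hp', q', hq', h⟩
      have h1 : (q + q') * (a - b) = p + p' := by linear_combination h
      have h2 : q + q' = 0 := by
        by_contra h0
        apply hx
        rw [eq_div_of_mul_eq h0 ((mul_comm _ _).trans h1), div_eq_mul_inv]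
        exact mul_mem (add_mem hp hp')
          (inv_mem_of_maximal_isSquareCone hP (add_mem hq hq'))
      have hq0 : q = 0 := hP.prop.eq_zero q hq (by
        rwa [← eq_neg_of_add_eq_zero_right h2])
      have hpp : p + p' = 0 := by rw [← h1, h2, zero_mul]
      have hp0 : p = 0 := hP.prop.eq_zero p hp (by
        rwa [← eq_neg_of_add_eq_zero_right hpp])
      simp [hq0, hp0]
  exact hP.le_of_ge hP' hle ⟨0, zero_mem P, 1, one_mem P, by ring⟩

/-- The field of differences of elements of a maximal cone. -/
def differenceField (hP : Maximal IsSquareCone P) : Subfield Ω where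
  carrier := {x | ∃ a ∈ P, ∃ b ∈ P, x = a - b}
  mul_mem' := by
    rintro z w ⟨p, hp, q, hq, rfl⟩ ⟨p', hp', q', hq', rfl⟩
    exact ⟨p * p' + q * q', add_mem (mul_mem hp hp') (mul_mem hq hq'), p * q' + q * p',
      add_mem (mul_mem hp hq') (mul_mem hq hp'), by ring⟩
  one_mem' := ⟨1, one_mem P, 0, zero_mem P, by simp⟩
  add_mem' := by
    rintro z w ⟨p, hp, q, hq, rfl⟩ ⟨p', hp', q', hq', rfl⟩
    exact ⟨p + p', add_mem hp hp', q + q', add_mem hq hq', by ring⟩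
  zero_mem' := ⟨0, zero_mem P, 0, zero_mem P, by simp⟩
  neg_mem' := by
    rintro z ⟨p, hp, q, hq, rfl⟩
    exact ⟨q, hq, p, hp, by ring⟩
  inv_mem' := by
    rintro z ⟨p, hp, q, hq, rfl⟩
    rcases mem_or_neg_mem_of_maximal_isSquareCone hP hp hq with h | h
    · exact ⟨_, inv_mem_of_maximal_isSquareCone hP h, 0, zero_mem P, by simp⟩
    · exact ⟨0, zero_mem P, _, inv_mem_of_maximal_isSquareCone hP h, by rw [inv_neg]; ring⟩

theorem exists_linearOrder_differenceField (hP : Maximal IsSquareCone P) :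
    ∃ (_ : LinearOrder (differenceField hP)) (_ : IsStrictOrderedRing (differenceField hP)),
      ∀ x : differenceField hP, 0 ≤ x ↔ (x : Ω) ∈ P := by
  classical
  let C : RingCone (differenceField hP) :=
    { P.comap (differenceField hP).subtype with
      eq_zero_of_mem_of_neg_mem' := fun {x} hx hx' =>
        Subtype.ext (hP.prop.eq_zero _ hx hx') }
  have : HasMemOrNegMem C := ⟨by
    rintro ⟨x, a, ha, b, hb, rfl⟩
    exact mem_or_neg_mem_of_maximal_isSquareCone hP ha hb⟩
  let inst : LinearOrder (differenceField hP) := .mkOfAddGroupCone C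
  have : IsOrderedRing (differenceField hP) := .mkOfCone C
  refine ⟨inst, IsOrderedRing.toIsStrictOrderedRing _, fun x => ?_⟩
  change x - 0 ∈ C ↔ _
  rw [sub_zero]
  rfl

end

section

open Polynomial

variable {K : Type} [Field K] [LinearOrder K] [IsStrictOrderedRing K]

theorem exists_nonneg_small_degree_of_mem_closure {p s : K[X]} (hp : 0 < p.natDegree)
    (hs : s ∈ AddSubmonoid.closure {f : K[X] | ∃ c : K, 0 ≤ c ∧ ∃ q : K[X], f = C c * q ^ 2}) :
    ∃ r : K[X], p ∣ s - r ∧ r.natDegree + 2 ≤ 2 * p.natDegree ∧ ∀ x, 0 ≤ r.eval x := by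
  induction hs using AddSubmonoid.closure_induction with
  | mem f hf =>
    obtain ⟨c, hc, q, rfl⟩ := hf
    refine ⟨C c * (q % p) ^ 2, ?_, ?_, fun x => ?_⟩
    · have h1 : q = p * (q / p) + q % p := (EuclideanDomain.div_add_mod q p).symm
      refine ⟨C c * (q / p) * (q + q % p), ?_⟩
      have h2 : q - q % p = p * (q / p) := by linear_combination h1
      linear_combination C c * (q + q % p) * h2
    · have h1 : (q % p).natDegree < p.natDegree := natDegree_mod_lt q hp.ne'
      have h2 : (C c * (q % p) ^ 2).natDegree ≤ 2 * (q % p).natDegree :=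
        (natDegree_C_mul_le _ _).trans natDegree_pow_le
      omega
    · simp only [eval_mul, eval_C, eval_pow]
      positivity
  | zero => exact ⟨0, by simp, by simp; omega, by simp⟩
  | add f g _ _ hf hg =>
    obtain ⟨r, h1, h2, h3⟩ := hf
    obtain ⟨r', h1', h2', h3'⟩ := hg
    refine ⟨r + r', ?_, ?_, fun x => ?_⟩
    · rw [add_sub_add_comm]
      exact dvd_add h1 h1'
    · have := natDegree_add_le r r'
      omega
    · rw [eval_add]
      exact add_nonneg (h3 x) (h3' x)

/-- An ordered field whose nonnegative cone is maximal inside an algebraically closed extension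
satisfies the intermediate value theorem for polynomials. -/
theorem hasPolyIVT_of_maximal {Ω : Type} [Field Ω] [IsAlgClosed Ω] [Algebra K Ω]
    (hmax : ∀ Q : Subsemiring Ω, IsSquareCone Q → (∀ x : K, 0 ≤ x → algebraMap K Ω x ∈ Q) →
      ∀ z ∈ Q, ∃ x : K, algebraMap K Ω x = z) : HasPolyIVT K := by
  intro p
  induction hn : p.natDegree using Nat.strong_induction_on generalizing p with
  | _ n ih =>
  subst hn
  intro a b hab hsign
  have hp0 : p ≠ 0 := by rintro rfl; simp at hsign
  have hdeg : 0 < p.natDegree := by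
    by_contra h0
    rw [eq_C_of_natDegree_eq_zero (p := p) (by omega)] at hsign
    simp only [eval_C] at hsign
    nlinarith [mul_self_nonneg (p.coeff 0)]
  by_cases hirr : Irreducible p
  swap
  · rw [irreducible_iff_lt_natDegree_lt hp0 (by
      rw [Polynomial.isUnit_iff_degree_eq_zero, degree_eq_natDegree hp0]
      exact_mod_cast hdeg.ne')] at hirr
    push Not at hirr
    obtain ⟨u, hu, hud, v, rfl⟩ := hirr
    have hv0 : v ≠ 0 := right_ne_zero_of_mul hp0
    have hu0 : u ≠ 0 := left_ne_zero_of_mul hp0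
    rw [natDegree_mul hu0 hv0] at ih hud
    rw [Finset.mem_Ioc] at hud
    simp only [eval_mul] at hsign
    have : u.eval a * u.eval b < 0 ∨ v.eval a * v.eval b < 0 := by
      by_contra! hcon
      have := mul_nonneg hcon.1 hcon.2
      linarith
    rcases this with h | h
    · obtain ⟨c, h1, h2, h3⟩ := ih _ (by omega) u rfl a b hab h
      exact ⟨c, h1, h2, by simp [h3]⟩
    · obtain ⟨c, h1, h2, h3⟩ := ih _ (by omega) v rfl a b hab h
      exact ⟨c, h1, h2, by simp [h3]⟩
  obtain ⟨α, hα⟩ := IsAlgClosed.exists_aeval_eq_zero Ω p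
    (by rw [degree_eq_natDegree hp0]; exact_mod_cast hdeg.ne')
  have hdvd : ∀ f : K[X], aeval α f = 0 → p ∣ f := by
    intro f hf
    rcases EuclideanDomain.dvd_or_coprime p f hirr with h | ⟨u, v, huv⟩
    · exact h
    · have := congrArg (aeval α) huv
      simp [hα, hf] at this
  let M : Submonoid K[X] :=
    { carrier := {f | ∃ c : K, 0 ≤ c ∧ ∃ q : K[X], f = C c * q ^ 2}
      one_mem' := ⟨1, zero_le_one, 1, by simp⟩
      mul_mem' := by
        rintro f g ⟨c, hc, q, rfl⟩ ⟨d, hd, r, rfl⟩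
        exact ⟨c * d, mul_nonneg hc hd, q * r, by rw [C_mul]; ring⟩ }
  let Q : Subsemiring Ω := M.subsemiringClosure.map (aeval (R := K) α).toRingHom
  have hgen : ∀ c : K, 0 ≤ c → ∀ q : K[X], aeval α (C c * q ^ 2) ∈ Q := fun c hc q =>
    ⟨C c * q ^ 2, AddSubmonoid.subset_closure ⟨c, hc, q, rfl⟩, rfl⟩
  have hsqQ : ∀ q : K[X], (aeval α q) ^ 2 ∈ Q := fun q => by
    simpa using hgen 1 zero_le_one q
  have hQ : IsSquareCone Q := by
    refine ⟨?_, ?_⟩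
    · rintro _ ⟨s, -, rfl⟩ _ ⟨t, -, rfl⟩
      simpa using hsqQ (s - t)
    · intro z hz hnz
      by_contra hz0
      obtain ⟨t, -, ht⟩ := id hz
      replace ht : aeval α t = z := ht
      obtain ⟨u, v, huv⟩ := (EuclideanDomain.dvd_or_coprime p t hirr).resolve_left (by
        rintro ⟨w, rfl⟩
        apply hz0
        rw [← ht, map_mul, hα, zero_mul])
      replace huv := congrArg (aeval α) huv
      simp only [map_add, map_mul, hα, mul_zero, zero_add, ht, map_one] at huv
      have hneg : (-1 : Ω) ∈ Q := by
        have : (-1 : Ω) = -z * z * (aeval α v) ^ 2 := by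
          linear_combination (1 + aeval α v * z) * huv
        rw [this]
        exact mul_mem (mul_mem hnz hz) (hsqQ v)
      obtain ⟨s, hs, hs1⟩ := hneg
      replace hs1 : aeval α s = -1 := hs1
      obtain ⟨r, hr1, hr2, hr3⟩ := exists_nonneg_small_degree_of_mem_closure hdeg hs
      obtain ⟨h, hh⟩ : p ∣ 1 + r := by
        have h1 : p ∣ 1 + s := hdvd _ (by simp [hs1])
        have := dvd_sub h1 hr1
        rwa [show 1 + s - (s - r) = 1 + r by ring] at this
      have hpos : ∀ x, 0 < p.eval x * h.eval x := fun x => by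
        rw [← eval_mul, ← hh, eval_add, eval_one]
        linarith [hr3 x]
      have hh0 : h ≠ 0 := by
        rintro rfl
        simpa using hpos 0
      have hhd : h.natDegree < p.natDegree := by
        have h1 := natDegree_add_le (1 : K[X]) r
        rw [hh, natDegree_mul hp0 hh0, natDegree_one] at h1
        omega
      obtain ⟨c, -, -, hc⟩ := ih _ hhd h rfl a b hab (by
        by_contra! hcon
        have h1 := mul_pos (hpos a) (hpos b)
        nlinarith)
      have := hpos c
      simp [hc] at this
  have key := hmax Q hQ (fun x hx => by simpa using hgen x hx 1)
  obtain ⟨u, hu⟩ := key _ (hsqQ (C 2⁻¹ * (X + 1)))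
  obtain ⟨v, hv⟩ := key _ (hsqQ (C 2⁻¹ * (X - 1)))
  have h4 : algebraMap K Ω 2⁻¹ * 2 = 1 := by
    rw [← map_ofNat (algebraMap K Ω) 2, ← map_mul]
    simp
  have hαK : algebraMap K Ω (u - v) = α := by
    rw [map_sub, hu, hv]
    simp only [map_mul, aeval_C, map_add, aeval_X, map_one, map_sub]
    linear_combination (algebraMap K Ω 2⁻¹ * 2 + 1) * α * h4
  have hroot : p.eval (u - v) = 0 := by
    rw [← hαK, aeval_algebraMap_apply] at hα
    simpa using hα
  obtain ⟨h, hh⟩ := dvd_iff_isRoot.2 hroot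
  have hhu : IsUnit h :=
    (hirr.isUnit_or_isUnit hh).resolve_left (not_isUnit_X_sub_C _)
  obtain ⟨k, -, rfl⟩ := Polynomial.isUnit_iff.1 hhu
  rw [hh] at hsign
  simp only [eval_mul, eval_sub, eval_X, eval_C] at hsign
  have hlt : (a - (u - v)) * (b - (u - v)) < 0 := by
    by_contra! hcon
    nlinarith [mul_nonneg hcon (mul_self_nonneg k)]
  rcases mul_neg_iff.1 hlt with ⟨h1, h2⟩ | ⟨h1, h2⟩
  · linarith
  · exact ⟨u - v, by linarith, by linarith, hroot⟩

theorem exists_hasPolyIVT_of_real (D : Type) [CommRing D] [IsDomain D]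
    (hD : ∀ s s' : D, IsSumSq s → IsSumSq s' → s + s' = 0 → s = 0) :
    ∃ (K : Type) (_ : Field K) (_ : LinearOrder K) (_ : IsStrictOrderedRing K) (χ : D →+* K),
      HasPolyIVT K ∧ Function.Injective χ := by
  let Ω := AlgebraicClosure (FractionRing D)
  let ι : D →+* Ω := (algebraMap (FractionRing D) Ω).comp (algebraMap D (FractionRing D))
  have hι : Function.Injective ι :=
    (algebraMap (FractionRing D) Ω).injective.comp (IsFractionRing.injective D (FractionRing D))
  have h0 : IsSquareCone ((Subsemiring.sumSq D).map ι) := by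
    refine ⟨?_, ?_⟩
    · rintro _ ⟨s, -, rfl⟩ _ ⟨t, -, rfl⟩
      refine ⟨(s - t) ^ 2, ?_, by simp⟩
      rw [sq]
      exact Subsemiring.mem_sumSq.2 (IsSumSq.mul_self _)
    · rintro _ ⟨s, hs, rfl⟩ ⟨t, ht, h⟩
      have : s + t = 0 := hι (by rw [map_add, h]; simp)
      rw [hD s t (Subsemiring.mem_sumSq.1 hs) (Subsemiring.mem_sumSq.1 ht) this, map_zero]
  obtain ⟨P, hP0, hP⟩ := h0.exists_maximal
  obtain ⟨i1, i2, hord⟩ := exists_linearOrder_differenceField hP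
  have hsq : ∀ d : D, ι d ^ 2 ∈ P := fun d => hP0 ⟨d * d, Subsemiring.mem_sumSq.2 (IsSumSq.mul_self d), by simp [sq]⟩
  have h2 : (2 : Ω) ≠ 0 := by
    intro h
    have h1 : (1 : D) * 1 + 1 * 1 = 0 := hι (by
      simp only [mul_one, map_add, map_one, map_zero]
      linear_combination h)
    exact one_ne_zero ((mul_one (1 : D)).symm.trans
      (hD _ _ (IsSumSq.mul_self 1) (IsSumSq.mul_self 1) h1))
  have hmem : ∀ d : D, ι d ∈ differenceField hP := by
    intro d
    have h4 : ι d = (ι (d + 1) ^ 2 - ι (d - 1) ^ 2) * (2⁻¹ * 2⁻¹) := by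
      simp only [map_add, map_sub, map_one]
      have h5 : (2 : Ω)⁻¹ * 2 = 1 := inv_mul_cancel₀ h2
      linear_combination (-(2 : Ω)⁻¹ * 2 - 1) * ι d * h5
    rw [h4]
    have h2m : (2 : Ω)⁻¹ ∈ differenceField hP := inv_mem (ofNat_mem _ 2)
    exact mul_mem ⟨_, hsq _, _, hsq _, rfl⟩ (mul_mem h2m h2m)
  refine ⟨differenceField hP, inferInstance, i1, i2, ι.codRestrict (differenceField hP) hmem,
    hasPolyIVT_of_maximal (Ω := Ω) fun Q hQ hle z hz => ?_, fun x y hxy => ?_⟩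
  · have hPQ : P ≤ Q := fun x hx =>
      hle ⟨x, x, hx, 0, zero_mem P, by simp⟩ ((hord _).2 hx)
    exact ⟨⟨z, z, hP.le_of_ge hQ hPQ hz, 0, zero_mem P, by simp⟩, rfl⟩
  · exact hι (congrArg Subtype.val hxy)

end

section

/-- An ideal is real if `a ^ 2 + s ∈ N` with `s` a sum of squares forces `a ∈ N`. -/
def IsRealIdeal {A : Type} [CommRing A] (N : Ideal A) : Prop :=
  ∀ a s : A, IsSumSq s → a * a + s ∈ N → a ∈ N

theorem IsRealIdeal.exists_prime {A : Type} [CommRing A] [IsNoetherianRing A] {N : Ideal A}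
    (hN : IsRealIdeal N) {f : A} (hf : f ∉ N) :
    ∃ p : Ideal A, p.IsPrime ∧ IsRealIdeal p ∧ N ≤ p ∧ f ∉ p := by
  let colon : A → Ideal A := fun h => Submodule.comap (LinearMap.mulLeft A h) N
  have hmem : ∀ h x, x ∈ colon h ↔ h * x ∈ N := fun h x => Iff.rfl
  obtain ⟨M, ⟨k, hk, rfl⟩, hmax⟩ := set_has_maximal_iff_noetherian.2 ‹IsNoetherianRing A›
    {I | ∃ k, f * k ∉ N ∧ I = colon (f * k)} ⟨_, 1, by simpa using hf, rfl⟩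
  refine ⟨colon (f * k), ⟨?_, fun {a b} hab => ?_⟩, fun a s hs has => ?_, fun x hx => ?_,
    fun h => ?_⟩
  · rw [Ideal.ne_top_iff_one, hmem, mul_one]
    exact hk
  · by_contra! hcon
    obtain ⟨ha, hb⟩ := hcon
    rw [hmem] at hab ha hb
    refine hmax (colon (f * (k * b))) ⟨k * b, by rwa [← mul_assoc], rfl⟩
      (SetLike.lt_iff_le_and_exists.2 ⟨fun x hx => ?_, a, ?_, ?_⟩)
    · rw [hmem] at hx ⊢
      have := N.mul_mem_left b hx
      rwa [show b * (f * k * x) = f * (k * b) * x by ring] at this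
    · rw [hmem]
      rwa [show f * (k * b) * a = f * k * (a * b) by ring]
    · rwa [hmem]
  · rw [hmem] at has ⊢
    refine hN _ (f * k * (f * k) * s) ((IsSumSq.mul_self _).mul hs) ?_
    have := N.mul_mem_left (f * k) has
    rwa [show f * k * (f * k * (a * a + s)) = f * k * a * (f * k * a) + f * k * (f * k) * s
      by ring] at this
  · exact N.mul_mem_left _ hx
  · rw [hmem] at h
    apply hk
    refine hN _ 0 .zero ?_
    have := N.mul_mem_left k h
    rwa [show k * (f * k * f) = f * k * (f * k) + 0 by ring] at this

theorem IsRealIdeal.eq_zero_of_isSumSq_add_eq_zero {A : Type} [CommRing A] {p : Ideal A}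
    (hp : IsRealIdeal p) (s s' : A ⧸ p) (hs : IsSumSq s) (hs' : IsSumSq s') (h : s + s' = 0) :
    s = 0 := by
  have lift : ∀ t : A ⧸ p, IsSumSq t → ∃ t' : A, IsSumSq t' ∧ Ideal.Quotient.mk p t' = t := by
    intro t ht
    induction ht with
    | zero => exact ⟨0, .zero, map_zero _⟩
    | sq_add a _ ih =>
      obtain ⟨u, hu, rfl⟩ := ih
      obtain ⟨b, rfl⟩ := Ideal.Quotient.mk_surjective a
      exact ⟨b * b + u, .sq_add b hu, by simp⟩
  induction hs generalizing s' with
  | zero => rfl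
  | @sq_add a t ht ih =>
    obtain ⟨b, rfl⟩ := Ideal.Quotient.mk_surjective a
    obtain ⟨u, hu, hu'⟩ := lift _ (ht.add hs')
    have hb : Ideal.Quotient.mk p b = 0 := by
      rw [Ideal.Quotient.eq_zero_iff_mem]
      refine hp b u hu ?_
      rw [← Ideal.Quotient.eq_zero_iff_mem, map_add, map_mul, hu', ← add_assoc, h]
    rw [hb] at h ⊢
    have := ih s' hs' (by simpa using h)
    simp [this]

theorem IsRealIdeal.exists_point {n : ℕ} {N : Ideal (MvPolynomial (Fin n) ℝ)}
    (hN : IsRealIdeal N) {f g : MvPolynomial (Fin n) ℝ} (hg : g ∈ N) (hf : f ∉ N) :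
    ∃ a : Fin n → ℝ, MvPolynomial.eval a g = 0 ∧ MvPolynomial.eval a f ≠ 0 := by
  obtain ⟨p, hprime, hp, hNp, hfp⟩ := hN.exists_prime hf
  obtain ⟨K, _, _, _, χ, hK, hχ⟩ := exists_hasPolyIVT_of_real (MvPolynomial (Fin n) ℝ ⧸ p)
    hp.eq_zero_of_isSumSq_add_eq_zero
  refine exists_real_point hK (χ.comp (Ideal.Quotient.mk p)) ?_ ?_
  · rw [RingHom.comp_apply, Ideal.Quotient.eq_zero_iff_mem.2 (hNp hg), map_zero]
  · rw [RingHom.comp_apply, Ne, map_eq_zero_iff χ hχ, Ideal.Quotient.eq_zero_iff_mem]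
    exact hfp

/-- The kernel of the bilinear form `(p, q) ↦ L (p * q)`. -/
def kernelIdeal {A : Type} [CommRing A] [Algebra ℝ A] (L : A →ₗ[ℝ] ℝ) : Ideal A where
  carrier := {p | ∀ q, L (p * q) = 0}
  add_mem' ha hb q := by rw [add_mul, map_add, ha, hb, add_zero]
  zero_mem' q := by simp
  smul_mem' c a ha q := by
    rw [smul_eq_mul, show c * a * q = a * (c * q) by ring]
    exact ha _

theorem isRealIdeal_kernelIdeal {A : Type} [CommRing A] [Algebra ℝ A] {L : A →ₗ[ℝ] ℝ}
    (hL : ∀ p, 0 ≤ L (p * p)) : IsRealIdeal (kernelIdeal L) := by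
  have hsum : ∀ s, IsSumSq s → 0 ≤ L s := by
    intro s hs
    induction hs with
    | zero => simp
    | sq_add a _ ih => rw [map_add]; exact add_nonneg (hL a) ih
  intro a s hs h q
  have h0 : L (a * a) = 0 := by
    have := h 1
    rw [mul_one, map_add] at this
    linarith [hL a, hsum s hs]
  have key : ∀ t : ℝ, 0 ≤ 2 * t * L (a * q) + L (q * q) := by
    intro t
    have h1 := hL (t • a + q)
    have h2 : (t • a + q) * (t • a + q) = (t * t) • (a * a) + (2 * t) • (a * q) + q * q := by
      simp only [Algebra.smul_def, map_mul, map_ofNat]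
      ring
    rw [h2, map_add, map_add, map_smul, map_smul, h0] at h1
    simpa using h1
  by_contra hne
  have h3 := key (-(L (q * q) + 1) / (2 * L (a * q)))
  rw [show 2 * (-(L (q * q) + 1) / (2 * L (a * q))) * L (a * q) = -(L (q * q) + 1) by
    field_simp] at h3
  linarith

open MvPolynomial

variable {n : ℕ}

theorem exists_eq_map_add_I_mul_map (Q : MvPolynomial (Fin n) ℂ) :
    ∃ u v : MvPolynomial (Fin n) ℝ,
      Q = map Complex.ofRealHom u + C Complex.I * map Complex.ofRealHom v := by
  induction Q using MvPolynomial.induction_on with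
  | C a =>
    refine ⟨C a.re, C a.im, ?_⟩
    rw [map_C, map_C, ← C_mul, ← C_add]
    congr 1
    rw [mul_comm]
    exact (Complex.re_add_im a).symm
  | add p q hp hq =>
    obtain ⟨u, v, rfl⟩ := hp
    obtain ⟨u', v', rfl⟩ := hq
    exact ⟨u + u', v + v', by simp only [map_add]; ring⟩
  | mul_X p i hp =>
    obtain ⟨u, v, rfl⟩ := hp
    exact ⟨u * X i, v * X i, by simp only [map_mul, map_X]; ring⟩

theorem starC_map_ofReal (u : MvPolynomial (Fin n) ℝ) :
    starC (map Complex.ofRealHom u) = map Complex.ofRealHom u := by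
  rw [starC, map_map]
  have : (starRingEnd ℂ).comp Complex.ofRealHom = Complex.ofRealHom :=
    RingHom.ext Complex.conj_ofReal
  rw [this]

theorem evalC_map_add (u v : MvPolynomial (Fin n) ℝ) (x : Fin n → ℝ) :
    evalC (map Complex.ofRealHom u + C Complex.I * map Complex.ofRealHom v) x
      = (eval x u : ℂ) + Complex.I * (eval x v : ℂ) := by
  have h : ∀ w : MvPolynomial (Fin n) ℝ,
      aeval (fun i => (x i : ℂ)) (map Complex.ofRealHom w) = (eval x w : ℂ) := by
    intro w
    rw [aeval_def, eval₂_map]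
    exact (eval₂_comp_left Complex.ofRealHom (RingHom.id ℝ) x w).symm
  rw [evalC, map_add, map_mul, h, h, aeval_C]
  rfl

theorem evalC_map_add_eq_zero_iff (u v : MvPolynomial (Fin n) ℝ) (x : Fin n → ℝ) :
    evalC (map Complex.ofRealHom u + C Complex.I * map Complex.ofRealHom v) x = 0
      ↔ eval x (u * u + v * v) = 0 := by
  rw [evalC_map_add, Complex.ext_iff]
  simp [mul_self_add_mul_self_eq_zero]

/-- The real part of a functional, restricted to real polynomials. -/
noncomputable def reFunctional (Λ : MvPolynomial (Fin n) ℂ →ₗ[ℂ] ℂ) :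
    MvPolynomial (Fin n) ℝ →ₗ[ℝ] ℝ where
  toFun p := (Λ (map Complex.ofRealHom p)).re
  map_add' p q := by simp
  map_smul' c p := by
    rw [smul_eq_C_mul, map_mul, map_C, ← smul_eq_C_mul, map_smul]
    simp

theorem reFunctional_apply (Λ : MvPolynomial (Fin n) ℂ →ₗ[ℂ] ℂ) (p : MvPolynomial (Fin n) ℝ) :
    reFunctional Λ p = (Λ (map Complex.ofRealHom p)).re := rfl

theorem IsPosDefC.map_mul_self_nonneg {Λ : MvPolynomial (Fin n) ℂ →ₗ[ℂ] ℂ} (hΛ : IsPosDefC Λ)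
    (p : MvPolynomial (Fin n) ℝ) : 0 ≤ Λ (map Complex.ofRealHom (p * p)) := by
  have := hΛ (map Complex.ofRealHom p)
  rwa [starC_map_ofReal, ← map_mul] at this

theorem IsPosDefC.map_ofReal_eq {Λ : MvPolynomial (Fin n) ℂ →ₗ[ℂ] ℂ} (hΛ : IsPosDefC Λ)
    (p : MvPolynomial (Fin n) ℝ) :
    Λ (map Complex.ofRealHom p) = (reFunctional Λ p : ℂ) := by
  have h1 := (Complex.nonneg_iff.1 (hΛ.map_mul_self_nonneg (p + 1))).2
  have h2 := (Complex.nonneg_iff.1 (hΛ.map_mul_self_nonneg p)).2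
  have h3 := (Complex.nonneg_iff.1 (hΛ.map_mul_self_nonneg 1)).2
  have h4 : (p + 1) * (p + 1) = p * p + p + p + 1 * 1 := by ring
  rw [h4] at h1
  simp only [map_add, Complex.add_im] at h1
  refine Complex.ext rfl ?_
  rw [Complex.ofReal_im]
  linarith

/-- A positive definite functional vanishing on `(P)` vanishes on every polynomial that vanishes
on the real zero set of `P`. -/
theorem IsPosDefC.vanishesOn_vanishingIdeal {Λ : MvPolynomial (Fin n) ℂ →ₗ[ℂ] ℂ}
    (hΛ : IsPosDefC Λ) {P : MvPolynomial (Fin n) ℂ} (hP : VanishesOnC Λ (Ideal.span {P})) :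
    VanishesOnC Λ (vanishingIdealC (zSetC P)) := by
  intro Q hQ
  have hN : IsRealIdeal (kernelIdeal (reFunctional Λ)) :=
    isRealIdeal_kernelIdeal fun p => (Complex.nonneg_iff.1 (hΛ.map_mul_self_nonneg p)).1
  obtain ⟨a, b, rfl⟩ := exists_eq_map_add_I_mul_map P
  obtain ⟨u, v, rfl⟩ := exists_eq_map_add_I_mul_map Q
  have hg : a * a + b * b ∈ kernelIdeal (reFunctional Λ) := by
    intro q
    rw [reFunctional_apply, hP, Complex.zero_re]
    have hI : (C Complex.I : MvPolynomial (Fin n) ℂ) * C Complex.I = -1 := by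
      rw [← C_mul, Complex.I_mul_I, C_neg, C_1]
    refine Ideal.mem_span_singleton.2
      ⟨(map Complex.ofRealHom a - C Complex.I * map Complex.ofRealHom b)
        * map Complex.ofRealHom q, ?_⟩
    simp only [map_mul, map_add]
    linear_combination
      (map Complex.ofRealHom b * map Complex.ofRealHom b * map Complex.ofRealHom q) * hI
  have hf : u * u + v * v ∈ kernelIdeal (reFunctional Λ) := by
    by_contra hf
    obtain ⟨x, hx, hx'⟩ := hN.exists_point hg hf
    exact hx' ((evalC_map_add_eq_zero_iff u v x).1
      (hQ x ((evalC_map_add_eq_zero_iff a b x).2 hx)))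
  have hu := hN u _ (IsSumSq.mul_self v) hf 1
  have hv := hN v _ (IsSumSq.mul_self u) (by rwa [add_comm]) 1
  rw [mul_one] at hu hv
  rw [map_add, ← smul_eq_C_mul, map_smul, hΛ.map_ofReal_eq, hΛ.map_ofReal_eq, hu, hv]
  simp

end

theorem stmt_4 (n : ℕ) (hn : 0 < n) (P : MvPolynomial (Fin n) ℂ) :
    IsTypeAC P ↔
      (∀ Λ : MvPolynomial (Fin n) ℂ →ₗ[ℂ] ℂ, IsPosDefC Λ →
        VanishesOnC Λ (vanishingIdealC (zSetC P)) → IsMomentC Λ) := by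
  refine ⟨fun h Λ hΛ hv => h Λ hΛ fun Q hQ => hv Q ?_,
    fun h Λ hΛ hv => h Λ hΛ (hΛ.vanishesOn_vanishingIdeal hv)⟩
  exact (Ideal.span_singleton_le_iff_mem _).2 (fun x hx => hx) hQ
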